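/- arXiv:2304.11781 — 7 statements merged into one kernel-verified Lean document; each statement's English description precedes it below -/
import Mathlib

section
/- The relation ≽ is a partial order on the set of all finite bit strings ⋃_{m≥0} {0,1}^m: it is reflexive (α ≽ α for every bit string α), transitive (α ≽ γ and γ ≽ δ imply α ≽ δ), and antisymmetric (α ≽ γ and γ ≽ α imply α = γ). -/
/-- `relPoly α x` is the reliability polynomial `I_α(x)`:
`I_∅(x) = x`, and `I_{a₁a₂⋯aℓ}(x) = I_{a₂⋯aℓ}(I_{a₁}(x))`
with `I_0(x) = x²` and `I_1(x) = 2x − x²`.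
`false` encodes the bit 0 and `true` encodes the bit 1. -/
noncomputable def relPoly : List Bool → ℝ → ℝ
  | [], x => x
  | (b :: α), x => relPoly α (if b then 2 * x - x ^ 2 else x ^ 2)

/-- `α ≽ γ` : `I_α(x) ≥ I_γ(x)` for all `x ∈ [0,1]`. -/
def outperforms (α γ : List Bool) : Prop :=
  ∀ x ∈ Set.Icc (0 : ℝ) 1, relPoly γ x ≤ relPoly α x

theorem relPoly_append_singleton (α : List Bool) (b : Bool) (x : ℝ) :
    relPoly (α ++ [b]) x =
      if b then 2 * relPoly α x - relPoly α x ^ 2 else relPoly α x ^ 2 := by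
  induction α generalizing x with
  | nil => rfl
  | cons c α ih => exact ih _

theorem relPoly_mem_Icc (α : List Bool) {x : ℝ} (hx : x ∈ Set.Icc (0 : ℝ) 1) :
    relPoly α x ∈ Set.Icc (0 : ℝ) 1 := by
  induction α generalizing x with
  | nil => exact hx
  | cons b α ih =>
    obtain ⟨h0, h1⟩ := hx
    apply ih
    cases b <;> simp only [Bool.false_eq_true, if_true, if_false] <;> constructor <;> nlinarith

theorem exists_polynomial_eval_eq_relPoly (α : List Bool) :
    ∃ p : Polynomial ℝ, ∀ x, relPoly α x = p.eval x := by
  induction α with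
  | nil => exact ⟨Polynomial.X, fun x => by simp [relPoly]⟩
  | cons b α ih =>
    obtain ⟨p, hp⟩ := ih
    refine ⟨p.comp (if b then 2 * Polynomial.X - Polynomial.X ^ 2 else Polynomial.X ^ 2),
      fun x => ?_⟩
    cases b <;> simp [relPoly, hp]

/-- Reliability polynomials agreeing on the unit interval agree on the whole real line. -/
theorem relPoly_eq_of_eqOn_Icc {α γ : List Bool}
    (h : Set.EqOn (relPoly α) (relPoly γ) (Set.Icc 0 1)) : relPoly α = relPoly γ := by
  obtain ⟨p, hp⟩ := exists_polynomial_eval_eq_relPoly α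
  obtain ⟨q, hq⟩ := exists_polynomial_eval_eq_relPoly γ
  have hpq : p = q := Polynomial.eq_of_infinite_eval_eq p q <|
    (Set.Icc_infinite (zero_lt_one' ℝ)).mono fun x hx => by
      simpa only [Set.mem_ofPred_eq, hp, hq] using h hx
  funext x
  rw [hp, hq, hpq]

theorem three_lt_abs_relPoly (α : List Bool) {x : ℝ} (hx : 3 < |x|) : 3 < |relPoly α x| := by
  induction α generalizing x with
  | nil => exact hx
  | cons b α ih =>
    apply ih
    cases b
    · rw [if_neg Bool.false_ne_true, abs_pow]
      nlinarith
    · rw [if_pos rfl]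
      rcases lt_abs.mp hx with h | h <;> exact lt_abs.mpr (Or.inr (by nlinarith))

theorem relPoly_append_false_nonneg (α : List Bool) (x : ℝ) :
    0 ≤ relPoly (α ++ [false]) x := by
  simp [relPoly_append_singleton, sq_nonneg]

theorem relPoly_append_true_le_one (α : List Bool) (x : ℝ) :
    relPoly (α ++ [true]) x ≤ 1 := by
  simp only [relPoly_append_singleton, if_true]
  nlinarith [sq_nonneg (relPoly α x - 1)]

theorem relPoly_nil_ne_append_singleton (α : List Bool) (b : Bool) :
    relPoly [] ≠ relPoly (α ++ [b]) := by
  intro h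
  cases b
  · have := relPoly_append_false_nonneg α (-1)
    rw [← h] at this
    norm_num [relPoly] at this
  · have := relPoly_append_true_le_one α 2
    rw [← h] at this
    norm_num [relPoly] at this

theorem relPoly_append_false_ne_append_true (α γ : List Bool) :
    relPoly (α ++ [false]) ≠ relPoly (γ ++ [true]) := by
  intro h
  have h0 := relPoly_append_false_nonneg α 4
  have h1 := relPoly_append_true_le_one γ 4
  have h3 := three_lt_abs_relPoly (α ++ [false]) (x := 4) (by norm_num)
  rw [abs_of_nonneg h0, h] at h3
  linarith

theorem relPoly_eqOn_Icc_of_append_singleton {α γ : List Bool} {b : Bool}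
    (h : relPoly (α ++ [b]) = relPoly (γ ++ [b])) :
    Set.EqOn (relPoly α) (relPoly γ) (Set.Icc 0 1) := by
  intro x hx
  obtain ⟨ha0, ha1⟩ := relPoly_mem_Icc α hx
  obtain ⟨hc0, hc1⟩ := relPoly_mem_Icc γ hx
  have hx' := congrFun h x
  simp only [relPoly_append_singleton] at hx'
  cases b
  · exact (sq_eq_sq₀ ha0 hc0).mp (by simpa using hx')
  · have : 1 - relPoly α x = 1 - relPoly γ x :=
      (sq_eq_sq₀ (sub_nonneg.mpr ha1) (sub_nonneg.mpr hc1)).mp (by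
        simp only [if_true] at hx'
        linarith)
    linarith

theorem relPoly_injective : Function.Injective relPoly := by
  intro α
  induction α using List.reverseRecOn with
  | nil =>
    intro γ h
    rcases List.eq_nil_or_concat' γ with rfl | ⟨γ, c, rfl⟩
    · rfl
    · exact absurd h (relPoly_nil_ne_append_singleton γ c)
  | append_singleton α b ih =>
    intro γ h
    rcases List.eq_nil_or_concat' γ with rfl | ⟨γ, c, rfl⟩
    · exact absurd h.symm (relPoly_nil_ne_append_singleton α b)
    · obtain rfl : b = c := by
        cases b <;> cases c
        · rfl
        · exact absurd h (relPoly_append_false_ne_append_true α γ)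
        · exact absurd h.symm (relPoly_append_false_ne_append_true γ α)
        · rfl
      rw [ih (relPoly_eq_of_eqOn_Icc (relPoly_eqOn_Icc_of_append_singleton h))]

/-- The relation ≽ is a partial order on the set of all finite bit strings:
reflexive, transitive, and antisymmetric. -/
theorem outperforms_partialOrder :
    (∀ α : List Bool, outperforms α α) ∧
    (∀ α γ δ : List Bool, outperforms α γ → outperforms γ δ → outperforms α δ) ∧
    (∀ α γ : List Bool, outperforms α γ → outperforms γ α → α = γ) := by
  exact ⟨fun _ _ _ => le_rfl, fun _ _ _ h₁ h₂ x hx => (h₂ x hx).trans (h₁ x hx),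
    fun _ _ h₁ h₂ => relPoly_injective <| relPoly_eq_of_eqOn_Icc fun x hx =>
      le_antisymm (h₂ x hx) (h₁ x hx)⟩
end

section
/- Rule Set C: for every integer k ≥ 0, the bit string 10 followed by k zeros followed by 01 outperforms the bit string 01 followed by k zeros followed by 10; that is, I_{10 0^k 01}(x) ≥ I_{01 0^k 10}(x) for all x ∈ [0,1]. -/
theorem relPoly_replicate_false_append (k : ℕ) (γ : List Bool) (x : ℝ) :
    relPoly (List.replicate k false ++ γ) x = relPoly γ (x ^ 2 ^ k) := by
  induction k generalizing x with
  | zero => simp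
  | succ k ih =>
    rw [List.replicate_succ, List.cons_append, relPoly, ih]
    rw [if_neg Bool.false_ne_true, ← pow_mul, ← pow_succ']

/-- The quintic that controls how `v ↦ v * √(2 - v ^ 2)` behaves under `v ↦ v * (2 - v)`. -/
theorem quintic_le_two_mul_sqrt_pow {v : ℝ} (h0 : 0 ≤ v) (h1 : v ≤ 1) :
    4 + 7 * v - 16 * v ^ 2 + 10 * v ^ 3 - 4 * v ^ 4 + v ^ 5 ≤
      2 * (2 - v ^ 2) * √(2 - v ^ 2) := by
  have hs : 0 ≤ 2 - v ^ 2 := by nlinarith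
  apply le_of_sq_le_sq _ (by positivity)
  rw [mul_pow, Real.sq_sqrt hs]
  obtain ⟨y, rfl⟩ : ∃ y, v = 1 - y := ⟨1 - v, by ring⟩
  have hy0 : 0 ≤ y := by linarith
  have hy1 : y ≤ 1 := by linarith
  have h2 : y ^ 2 ≤ 1 := pow_le_one₀ hy0 hy1
  have h4 : y ^ 4 ≤ y := pow_le_of_le_one hy0 hy1 (by norm_num)
  have h6 : y ^ 6 ≤ y := pow_le_of_le_one hy0 hy1 (by norm_num)
  have h : 0 ≤ y ^ 4 * (8 + 16 * y - 8 * y ^ 2 + 8 * y ^ 3 - 9 * y ^ 4 + 2 * y ^ 5 - y ^ 6) := by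
    have h3 : 0 ≤ y ^ 3 := by positivity
    have h5 : 0 ≤ y ^ 5 := by positivity
    exact mul_nonneg (by positivity) (by linarith)
  linarith

/-- Squaring both arguments preserves the comparison of `I_1` with `I_0 ∘ I_1`. -/
theorem sq_two_mul_sub_sq_le_of_le {a b : ℝ} (ha0 : 0 ≤ a) (ha1 : a ≤ 1) (hb0 : 0 ≤ b)
    (hb1 : b ≤ 1) (h : (2 * b - b ^ 2) ^ 2 ≤ 2 * a - a ^ 2) :
    (2 * b ^ 2 - (b ^ 2) ^ 2) ^ 2 ≤ 2 * a ^ 2 - (a ^ 2) ^ 2 := by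
  obtain ⟨u, rfl⟩ : ∃ u, a = 1 - u := ⟨1 - a, by ring⟩
  obtain ⟨v, rfl⟩ : ∃ v, b = 1 - v := ⟨1 - b, by ring⟩
  have hv0 : 0 ≤ v := by linarith
  have hv1 : v ≤ 1 := by linarith
  have hs : 0 ≤ 2 - v ^ 2 := by nlinarith
  have hq := quintic_le_two_mul_sqrt_pow hv0 hv1
  set r := √(2 - v ^ 2)
  have hr : r ^ 2 = 2 - v ^ 2 := Real.sq_sqrt hs
  have hr0 : 0 ≤ r := Real.sqrt_nonneg _
  have hut : u ≤ v * r := by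
    apply le_of_sq_le_sq _ (by positivity)
    rw [mul_pow, hr]
    linarith
  have ht1 : v * r ≤ 1 := by
    apply le_of_sq_le_sq _ (by norm_num)
    rw [mul_pow, hr]
    linarith [sq_nonneg (v ^ 2 - 1)]
  have hu : (u * (2 - u)) ^ 2 ≤ (v * r * (2 - v * r)) ^ 2 :=
    pow_le_pow_left₀ (by nlinarith) (by nlinarith) 2
  have ht : (v * r * (2 - v * r)) ^ 2 =
      v ^ 2 * (2 - v ^ 2) * (4 + v ^ 2 * (2 - v ^ 2)) - v ^ 2 * (4 * v * (2 - v ^ 2) * r) := by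
    linear_combination (v ^ 2 * (4 - 4 * v * r + v ^ 2 * (r ^ 2 + 2 - v ^ 2))) * hr
  have hv3 : 0 ≤ 2 * v ^ 3 := by positivity
  linarith [mul_le_mul_of_nonneg_left hq hv3]

theorem sq_two_mul_sub_sq_le_base {x : ℝ} (h0 : 0 ≤ x) (h1 : x ≤ 1) :
    (2 * (2 * x ^ 2 - (x ^ 2) ^ 2) - (2 * x ^ 2 - (x ^ 2) ^ 2) ^ 2) ^ 2 ≤
      2 * (2 * x - x ^ 2) ^ 4 - ((2 * x - x ^ 2) ^ 4) ^ 2 := by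
  have hx : 0 ≤ 1 - x := by linarith
  have hc : 0 ≤ 48 - 2 * x + 2 * x ^ 2 := by nlinarith
  have h : 0 ≤ x ^ 4 * (1 - x) ^ 4 *
      (16 + x ^ 3 * (1 - x) ^ 3 * (48 - 2 * x + 2 * x ^ 2)) := by positivity
  linarith

/-- Rule Set C: 10 0^k 01 outperforms 01 0^k 10 for every integer k >= 0. -/
theorem ruleSetC (k : ℕ) :
    outperforms ([true, false] ++ List.replicate k false ++ [false, true])
      ([false, true] ++ List.replicate k false ++ [true, false]) := by
  rintro x ⟨h0, h1⟩
  have ha0 : 0 ≤ (2 * x - x ^ 2) ^ 4 := by positivity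
  have ha1 : (2 * x - x ^ 2) ^ 4 ≤ 1 :=
    pow_le_one₀ (by nlinarith) (by linarith [sq_nonneg (x - 1)])
  have hb0 : 0 ≤ 2 * x ^ 2 - (x ^ 2) ^ 2 := by
    nlinarith [sq_nonneg x, pow_le_one₀ (n := 2) h0 h1]
  have hb1 : 2 * x ^ 2 - (x ^ 2) ^ 2 ≤ 1 := by linarith [sq_nonneg (x ^ 2 - 1)]
  have key : (2 * (2 * x ^ 2 - (x ^ 2) ^ 2) ^ 2 ^ k -
      ((2 * x ^ 2 - (x ^ 2) ^ 2) ^ 2 ^ k) ^ 2) ^ 2 ≤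
      2 * ((2 * x - x ^ 2) ^ 4) ^ 2 ^ k - (((2 * x - x ^ 2) ^ 4) ^ 2 ^ k) ^ 2 := by
    induction k with
    | zero => simpa using sq_two_mul_sub_sq_le_base h0 h1
    | succ k ih =>
      rw [pow_succ 2 k, pow_mul _ (2 ^ k) 2, pow_mul _ (2 ^ k) 2]
      exact sq_two_mul_sub_sq_le_of_le (by positivity) (pow_le_one₀ ha0 ha1)
        (by positivity) (pow_le_one₀ hb0 hb1) ih
  have e : (((2 * x - x ^ 2) ^ 2) ^ 2 ^ k) ^ 2 = ((2 * x - x ^ 2) ^ 4) ^ 2 ^ k := by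
    rw [← pow_mul, ← pow_mul, ← pow_mul]
    congr 1
    ring
  simp only [List.cons_append, List.nil_append, relPoly,
    relPoly_replicate_false_append, if_true, Bool.false_eq_true, if_false, e]
  exact key
end

section
/- Rule Set F: the bit string 011 outperforms the bit string 10; concretely, I_{011}(x) − I_{10}(x) = x³(x − 1)²(4 + x − 2x² − x³), and this quantity is nonnegative for all x ∈ [0,1]. -/
/-- Rule Set F: the bit string 011 outperforms the bit string 10; concretely
I_011(x) - I_10(x) = x^3 (x-1)^2 (4 + x - 2x^2 - x^3), nonnegative on [0,1]. -/
theorem ruleSetF :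
    (∀ x : ℝ, relPoly [false, true, true] x - relPoly [true, false] x
        = x ^ 3 * (x - 1) ^ 2 * (4 + x - 2 * x ^ 2 - x ^ 3)) ∧
    (∀ x ∈ Set.Icc (0 : ℝ) 1,
        0 ≤ relPoly [false, true, true] x - relPoly [true, false] x) := by
  have key : ∀ x : ℝ, relPoly [false, true, true] x - relPoly [true, false] x
      = x ^ 3 * (x - 1) ^ 2 * (4 + x - 2 * x ^ 2 - x ^ 3) := by
    intro x
    simp only [relPoly, if_true, Bool.false_eq_true, if_false]
    ring
  refine ⟨key, fun x ⟨h0, h1⟩ => ?_⟩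
  rw [key]
  have h2 : x ^ 2 ≤ 1 := pow_le_one₀ h0 h1
  have h3 : x ^ 3 ≤ 1 := pow_le_one₀ h0 h1
  have h4 : 0 ≤ 4 + x - 2 * x ^ 2 - x ^ 3 := by linarith
  positivity
end

section
/- Exponent and mantissa of a reliability polynomial: let α ∈ {0,1}^ℓ be a bit string with exactly z zeros. Then the smallest exponent i such that the coefficient of x^i in the polynomial I_α is nonzero equals 2^z, and the coefficient of x^{2^z} in I_α equals 2^S, where S = Σ_{k=1}^{ℓ−z} 2^{c_k} and c_k is the number of 0's appearing strictly to the right of the k-th 1 in α. -/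
open Polynomial

/-- `relP α` is the reliability polynomial I_α of the bit string α, as a real
polynomial: I_empty = X, and I_(b :: α) = I_α composed with I_b, where
I_0 = X^2 and I_1 = 2X - X^2. `false` encodes the bit 0, `true` the bit 1. -/
noncomputable def relP : List Bool → Polynomial ℝ
  | [] => X
  | (b :: α) => (relP α).comp (if b then 2 * X - X ^ 2 else X ^ 2)

/-- Factoring `X ^ (2 ^ z)` out of `relP α` leaves a polynomial whose constant coefficient is
the mantissa. -/
theorem exists_relP_eq_X_pow_mul (α : List Bool) :
    ∃ g : ℝ[X], relP α = X ^ (2 ^ α.count false) * g ∧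
      g.eval 0 = 2 ^ (∑ i ∈ Finset.range α.length,
        if α.getD i false then 2 ^ ((α.drop (i + 1)).count false) else 0) := by
  induction α with
  | nil => exact ⟨1, by simp [relP], by simp⟩
  | cons b α ih =>
    obtain ⟨g, hg, hg0⟩ := ih
    rw [relP, hg, List.length_cons, Finset.sum_range_succ']
    cases b
    · refine ⟨g.comp (X ^ 2), ?_, by simpa [eval_comp] using hg0⟩
      simp [pow_succ', pow_mul]
    · have hX : (2 * X - X ^ 2 : ℝ[X]) = X * (2 - X) := by ring
      refine ⟨(2 - X) ^ 2 ^ α.count false * g.comp (X * (2 - X)), ?_, ?_⟩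
      · simp [hX, mul_pow, mul_assoc]
      · simp [eval_comp, pow_add, hg0, mul_comm]

/-- Exponent and mantissa of a reliability polynomial: if α has z zeros, the
smallest exponent with nonzero coefficient in I_α is 2^z, and the coefficient
of x^(2^z) is 2^S where S = Σ over the ones of α of 2^(number of zeros
strictly to the right of that one). -/
theorem relP_trailing (α : List Bool) :
    (relP α).natTrailingDegree = 2 ^ α.count false ∧
    (relP α).coeff (2 ^ α.count false) =
      2 ^ (∑ i ∈ Finset.range α.length,
        if α.getD i false then 2 ^ ((α.drop (i + 1)).count false) else 0) := by
  obtain ⟨g, hg, hg0⟩ := exists_relP_eq_X_pow_mul α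
  have hcoeff : (relP α).coeff (2 ^ α.count false) = g.eval 0 := by
    rw [hg, ← coeff_zero_eq_eval_zero]
    simpa using coeff_X_pow_mul g (2 ^ α.count false) 0
  have hne : (relP α).coeff (2 ^ α.count false) ≠ 0 := by
    rw [hcoeff, hg0]
    positivity
  refine ⟨le_antisymm (natTrailingDegree_le_of_ne_zero hne) ?_, hcoeff.trans hg0⟩
  refine le_natTrailingDegree (fun h => hne (by simp [h])) fun i hi => ?_
  rw [hg, coeff_X_pow_mul', if_neg hi.not_ge]
end

section
/- If α and γ are bit strings such that α contains strictly more ones than γ and also strictly more zeros than γ, then α and γ are incomparable under ≽: neither α ≽ γ nor γ ≽ α holds. -/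
/-- The lowest-order term of the reliability polynomial, without its coefficient, bounds it from
below on `[0,1]`. -/
theorem pow_le_relPoly (α : List Bool) {x : ℝ} (hx0 : 0 ≤ x) (hx1 : x ≤ 1) :
    x ^ 2 ^ α.count false ≤ relPoly α x := by
  induction α generalizing x with
  | nil => simp [relPoly]
  | cons b α ih =>
    cases b with
    | false =>
      have h := ih (sq_nonneg x) (pow_le_one₀ hx0 hx1)
      rw [← pow_mul, ← pow_succ'] at h
      simpa [relPoly] using h
    | true =>
      have hle : x ≤ 2 * x - x ^ 2 := by nlinarith
      have h := ih (x := 2 * x - x ^ 2) (by linarith) (by nlinarith [sq_nonneg (x - 1)])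
      simpa [relPoly] using (pow_le_pow_left₀ hx0 hle _).trans h

theorem exists_relPoly_le_mul_pow (α : List Bool) :
    ∃ C : ℝ, 0 < C ∧
      ∀ x : ℝ, 0 ≤ x → x ≤ 1 → relPoly α x ≤ C * x ^ 2 ^ α.count false := by
  induction α with
  | nil => exact ⟨1, one_pos, fun x _ _ => by simp [relPoly]⟩
  | cons b α ih =>
    obtain ⟨C, hC, ih⟩ := ih
    cases b with
    | false =>
      refine ⟨C, hC, fun x hx0 hx1 => ?_⟩
      have h := ih (x ^ 2) (sq_nonneg x) (pow_le_one₀ hx0 hx1)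
      rw [← pow_mul, ← pow_succ'] at h
      simpa [relPoly] using h
    | true =>
      refine ⟨C * 2 ^ 2 ^ α.count false, by positivity, fun x hx0 hx1 => ?_⟩
      have hnonneg : 0 ≤ 2 * x - x ^ 2 := by nlinarith
      have h := ih (2 * x - x ^ 2) hnonneg (by nlinarith [sq_nonneg (x - 1)])
      have hpow : (2 * x - x ^ 2) ^ 2 ^ α.count false ≤ (2 * x) ^ 2 ^ α.count false :=
        pow_le_pow_left₀ hnonneg (by linarith [sq_nonneg x]) _
      have h' := h.trans (mul_le_mul_of_nonneg_left hpow hC.le)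
      rw [mul_pow, ← mul_assoc] at h'
      simpa [relPoly] using h'

/-- A string with more zeros has a strictly smaller reliability polynomial somewhere near `0`. -/
theorem not_outperforms_of_count_false_lt {α γ : List Bool}
    (h0 : γ.count false < α.count false) : ¬ outperforms α γ := by
  intro h
  obtain ⟨C, hC, hup⟩ := exists_relPoly_le_mul_pow α
  set x : ℝ := 1 / (C + 1) with hx
  have hx0 : 0 < x := by positivity
  have hx1 : x ≤ 1 := by rw [hx, div_le_one (by positivity)]; linarith
  have hexp : 2 ^ γ.count false + 1 ≤ 2 ^ α.count false :=
    Nat.pow_lt_pow_right one_lt_two h0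
  have hle : x ^ 2 ^ γ.count false ≤ C * x * x ^ 2 ^ γ.count false := by
    calc x ^ 2 ^ γ.count false ≤ relPoly γ x := pow_le_relPoly γ hx0.le hx1
      _ ≤ relPoly α x := h x ⟨hx0.le, hx1⟩
      _ ≤ C * x ^ 2 ^ α.count false := hup x hx0.le hx1
      _ ≤ C * x ^ (2 ^ γ.count false + 1) :=
        mul_le_mul_of_nonneg_left (pow_le_pow_of_le_one hx0.le hx1 hexp) hC.le
      _ = C * x * x ^ 2 ^ γ.count false := by ring
  have hCx : C * x < 1 := by
    rw [hx, mul_one_div, div_lt_one (by positivity)]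
    linarith
  have hlt := mul_lt_mul_of_pos_right hCx (pow_pos hx0 (2 ^ γ.count false))
  linarith

/-- Duality: exchanging zeros and ones reflects the reliability polynomial in `(1/2, 1/2)`. -/
theorem relPoly_map_not (α : List Bool) (x : ℝ) :
    relPoly (α.map not) x = 1 - relPoly α (1 - x) := by
  induction α generalizing x with
  | nil => simp [relPoly]
  | cons b α ih =>
    cases b <;> simp only [List.map_cons, relPoly, ih] <;> congr 2 <;> simp <;> ring

theorem outperforms_map_not {α γ : List Bool} (h : outperforms γ α) :
    outperforms (α.map not) (γ.map not) := by
  rintro x ⟨hx0, hx1⟩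
  rw [relPoly_map_not, relPoly_map_not]
  linarith [h (1 - x) ⟨by linarith, by linarith⟩]

theorem count_false_map_not (α : List Bool) : (α.map not).count false = α.count true :=
  List.count_map_of_injective α not Bool.not_injective true

/-- If α has strictly more ones and strictly more zeros than γ, then
α and γ are incomparable under ≽. -/
theorem incomparable_of_more_ones_and_zeros (α γ : List Bool)
    (h1 : γ.count true < α.count true) (h0 : γ.count false < α.count false) :
    ¬ outperforms α γ ∧ ¬ outperforms γ α := by
  refine ⟨not_outperforms_of_count_false_lt h0, fun h => ?_⟩
  refine not_outperforms_of_count_false_lt ?_ (outperforms_map_not h)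
  simpa only [count_false_map_not] using h1
end

section
/- Incompatibility of beta expansion with Rule Set D: for every integer k ≥ 1 and every real β > 1, if (0^k 1^{2^k})_β ≥ (1^k 0^{2^k})_β, then β^k ≤ 2 (equivalently β ≤ 2^{1/k}). Since 2^{1/k} → 1 as k → ∞, no fixed β > 1 is compatible with Rule Set D for all k. -/
/-- Beta expansion of a bit string α = a₁a₂⋯aℓ : α_β = Σ_{i=1}^{ℓ} aᵢ β^(ℓ−i).
`false` encodes the bit 0 and `true` encodes the bit 1. -/
noncomputable def betaExp (β : ℝ) (α : List Bool) : ℝ :=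
  ∑ i ∈ Finset.range α.length, if α.getD i false then β ^ (α.length - 1 - i) else 0

theorem betaExp_cons (β : ℝ) (b : Bool) (l : List Bool) :
    betaExp β (b :: l) = (if b then β ^ l.length else 0) + betaExp β l := by
  simp only [betaExp, List.length_cons, Finset.sum_range_succ', List.getD_cons_succ,
    List.getD_cons_zero, Nat.add_sub_cancel, Nat.sub_zero]
  rw [add_comm]
  congr 1
  refine Finset.sum_congr rfl fun i _ => ?_
  rw [Nat.sub_sub, Nat.add_comm 1 i]

theorem betaExp_append (β : ℝ) (l m : List Bool) :
    betaExp β (l ++ m) = betaExp β l * β ^ m.length + betaExp β m := by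
  induction l with
  | nil => simp [betaExp]
  | cons b l ih =>
    rw [List.cons_append, betaExp_cons, betaExp_cons, ih, List.length_append, pow_add]
    split_ifs <;> ring

theorem betaExp_replicate_false (β : ℝ) (n : ℕ) :
    betaExp β (List.replicate n false) = 0 := by
  induction n with
  | zero => simp [betaExp]
  | succ n ih => simp [List.replicate_succ, betaExp_cons, ih]

theorem betaExp_replicate_true_mul (β : ℝ) (n : ℕ) :
    betaExp β (List.replicate n true) * (β - 1) = β ^ n - 1 := by
  induction n with
  | zero => simp [betaExp]
  | succ n ih =>
    rw [List.replicate_succ, betaExp_cons, add_mul, ih]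
    simp only [if_true, List.length_replicate]
    ring

/-- Incompatibility of beta expansion with Rule Set D: for k ≥ 1 and β > 1,
if (0^k 1^(2^k))_β ≥ (1^k 0^(2^k))_β then β^k ≤ 2. -/
theorem betaExp_ruleSetD_incompatible (k : ℕ) (hk : 1 ≤ k) (β : ℝ) (hβ : 1 < β)
    (h : betaExp β (List.replicate k true ++ List.replicate (2 ^ k) false) ≤
      betaExp β (List.replicate k false ++ List.replicate (2 ^ k) true)) :
    β ^ k ≤ 2 := by
  rw [betaExp_append, betaExp_append, betaExp_replicate_false, betaExp_replicate_false,
    List.length_replicate, zero_mul, zero_add, add_zero] at h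
  have h' := mul_le_mul_of_nonneg_right h (sub_pos.2 hβ).le
  rw [mul_right_comm, betaExp_replicate_true_mul, betaExp_replicate_true_mul] at h'
  have hpos : 0 < β ^ 2 ^ k := by positivity
  by_contra! hlt
  nlinarith [mul_pos (sub_pos.2 hlt) hpos]
end

section
/- For every integer k ≥ 0 and every real β, the beta expansion of the bitwise complement of the length-2^k Thue–Morse prefix minus the beta expansion of the prefix itself satisfies (complement of τ_1⋯τ_{2^k})_β − (τ_1⋯τ_{2^k})_β = Π_{j=0}^{k−1} (β^{2^j} − 1); consequently (τ_1⋯τ_{2^k})_β ≤ (complement of τ_1⋯τ_{2^k})_β whenever β ≥ 1. -/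
/-- The Thue-Morse word: `thueMorse i` is the (i+1)-st letter, i.e. the parity
of the number of 1's in the binary representation of i. -/
def thueMorse (i : ℕ) : Bool := decide ((Nat.digits 2 i).count 1 % 2 = 1)

theorem thueMorse_two_mul (i : ℕ) : thueMorse (2 * i) = thueMorse i := by
  rcases Nat.eq_zero_or_pos i with rfl | hi
  · rfl
  · simp [thueMorse, Nat.digits_def' one_lt_two (show 0 < 2 * i by omega)]

theorem thueMorse_two_mul_add_one (i : ℕ) : thueMorse (2 * i + 1) = !thueMorse i := by
  have h : (2 * i + 1) / 2 = i := by omega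
  have h' : (2 * i + 1) % 2 = 1 := by omega
  rw [thueMorse, thueMorse, Nat.digits_def' one_lt_two (Nat.succ_pos _), h, h',
    List.count_cons_self, ← decide_not, decide_eq_decide]
  omega

theorem Finset.sum_range_two_mul {M : Type*} [AddCommMonoid M] (f : ℕ → M) (n : ℕ) :
    ∑ i ∈ Finset.range (2 * n), f i = ∑ i ∈ Finset.range n, (f (2 * i) + f (2 * i + 1)) := by
  induction n with
  | zero => simp
  | succ n ih =>
    rw [Finset.sum_range_succ, ← ih, mul_add_one, Finset.sum_range_succ, Finset.sum_range_succ,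
      add_assoc]

theorem betaExp_map_range (β : ℝ) (f : ℕ → Bool) (n : ℕ) :
    betaExp β ((List.range n).map f) =
      ∑ i ∈ Finset.range n, if f i then β ^ (n - 1 - i) else 0 := by
  unfold betaExp
  rw [List.length_map, List.length_range]
  refine Finset.sum_congr rfl fun i hi => ?_
  simp [List.getD_eq_getElem?_getD, Finset.mem_range.mp hi]

theorem betaExp_not_sub_betaExp (β : ℝ) (f : ℕ → Bool) (n : ℕ) :
    betaExp β (((List.range n).map f).map (fun b => !b)) - betaExp β ((List.range n).map f) =
      ∑ i ∈ Finset.range n, (if f i then -1 else 1) * β ^ (n - 1 - i) := by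
  rw [List.map_map, betaExp_map_range, betaExp_map_range, ← Finset.sum_sub_distrib]
  refine Finset.sum_congr rfl fun i _ => ?_
  cases h : f i <;> simp [h]

theorem sum_thueMorse_sign_mul_pow (k : ℕ) (β : ℝ) :
    ∑ i ∈ Finset.range (2 ^ k), (if thueMorse i then -1 else 1) * β ^ (2 ^ k - 1 - i) =
      ∏ j ∈ Finset.range k, (β ^ (2 ^ j) - 1) := by
  induction k generalizing β with
  | zero => simp [thueMorse]
  | succ k ih =>
    have hprod : ∏ j ∈ Finset.range k, (β ^ (2 ^ (j + 1)) - 1) =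
        ∏ j ∈ Finset.range k, ((β ^ 2) ^ (2 ^ j) - 1) := by
      simp_rw [← pow_mul, pow_succ']
    rw [Finset.prod_range_succ', hprod, ← ih, pow_succ', Finset.sum_range_two_mul,
      Finset.sum_mul]
    refine Finset.sum_congr rfl fun i hi => ?_
    have hi := Finset.mem_range.mp hi
    have heven : 2 * 2 ^ k - 1 - 2 * i = 2 * (2 ^ k - 1 - i) + 1 := by omega
    have hodd : 2 * 2 ^ k - 1 - (2 * i + 1) = 2 * (2 ^ k - 1 - i) := by omega
    rw [thueMorse_two_mul, thueMorse_two_mul_add_one, heven, hodd, ← pow_mul]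
    cases thueMorse i <;> simp <;> ring

/-- (complement of τ₁⋯τ_{2^k})_β − (τ₁⋯τ_{2^k})_β = Π_{j=0}^{k−1} (β^(2^j) − 1);
hence the prefix is beta-dominated by its complement whenever β ≥ 1. -/
theorem betaExp_thueMorse (k : ℕ) (β : ℝ) :
    betaExp β (((List.range (2 ^ k)).map thueMorse).map (fun b => !b)) -
        betaExp β ((List.range (2 ^ k)).map thueMorse) =
      ∏ j ∈ Finset.range k, (β ^ (2 ^ j) - 1) ∧
    (1 ≤ β →
      betaExp β ((List.range (2 ^ k)).map thueMorse) ≤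
        betaExp β (((List.range (2 ^ k)).map thueMorse).map (fun b => !b))) := by
  have h := (betaExp_not_sub_betaExp β thueMorse (2 ^ k)).trans (sum_thueMorse_sign_mul_pow k β)
  refine ⟨h, fun hβ => sub_nonneg.mp ?_⟩
  rw [h]
  exact Finset.prod_nonneg fun j _ => sub_nonneg.mpr (one_le_pow₀ hβ)
end
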